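/- Let A be an indecomposable symmetrizable generalized Cartan matrix of size n, and let c = σ_{v_n} ⋯ σ_{v_1} be a Coxeter element of the Weyl group W(A) (where v_1,…,v_n is a permutation of 1,…,n). Then W(A) is infinite if and only if for all integers m, the length of c^m equals |m|·n. -/

import Mathlib

open Finset

variable {n : ℕ}

/-- The function underlying the simple reflection `σ_i(e_j) = e_j - a_{ij} e_i` on `ℤ^n`. -/
def reflFun (A : Matrix (Fin n) (Fin n) ℤ) (i : Fin n) : (Fin n → ℤ) → (Fin n → ℤ) :=
  fun v j => v j - if j = i then ∑ k, A i k * v k else 0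

lemma reflFun_invol (A : Matrix (Fin n) (Fin n) ℤ) (h2 : ∀ i, A i i = 2) (i : Fin n) :
    ∀ v, reflFun A i (reflFun A i v) = v := by
  intro v
  funext j
  simp only [reflFun]
  by_cases hj : j = i
  · subst hj
    have hs : ∀ k, A j k * (v k - if k = j then ∑ m, A j m * v m else 0)
        = A j k * v k - (if k = j then A j k * (∑ m, A j m * v m) else 0) := by
      intro k
      by_cases hk : k = j <;> simp [hk, mul_sub]
    simp only [if_pos rfl, hs, Finset.sum_sub_distrib, Finset.sum_ite_eq', Finset.mem_univ,
      if_true, h2]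
    ring
  · simp [hj]

/-- The simple reflection `σ_i` as a permutation of `ℤ^n`. -/
def simpleRefl (A : Matrix (Fin n) (Fin n) ℤ) (h2 : ∀ i, A i i = 2) (i : Fin n) :
    Equiv.Perm (Fin n → ℤ) :=
  ⟨reflFun A i, reflFun A i, reflFun_invol A h2 i, reflFun_invol A h2 i⟩

/-- The Weyl group `W(A)`, the subgroup of bijections of `ℤ^n` generated by the `σ_i`. -/
def weylGroup (A : Matrix (Fin n) (Fin n) ℤ) (h2 : ∀ i, A i i = 2) :
    Subgroup (Equiv.Perm (Fin n → ℤ)) :=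
  Subgroup.closure (Set.range (simpleRefl A h2))

/-- The length `ℓ(w)`: the least number of simple reflections with product `w`. -/
noncomputable def weylLength (A : Matrix (Fin n) (Fin n) ℤ) (h2 : ∀ i, A i i = 2)
    (w : Equiv.Perm (Fin n → ℤ)) : ℕ :=
  sInf {t | ∃ l : List (Fin n), l.length = t ∧ (l.map (simpleRefl A h2)).prod = w}

/-- The word `w(S) = σ_{x_s} ⋯ σ_{x_1}` associated to a sequence `S = x_1, …, x_s`. -/
def wordOf (A : Matrix (Fin n) (Fin n) ℤ) (h2 : ∀ i, A i i = 2) (S : List (Fin n)) :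
    Equiv.Perm (Fin n → ℤ) :=
  (S.reverse.map (simpleRefl A h2)).prod


section Aux

/-- product of a word -/
def pr (A : Matrix (Fin n) (Fin n) ℤ) (h2 : ∀ i, A i i = 2) (l : List (Fin n)) :
    Equiv.Perm (Fin n → ℤ) := (l.map (simpleRefl A h2)).prod

/-- simple root -/
def rt (s : Fin n) : Fin n → ℤ := Pi.single s 1

variable (A : Matrix (Fin n) (Fin n) ℤ) (h2 : ∀ i, A i i = 2)

lemma pr_nil : pr A h2 [] = 1 := rfl

lemma pr_cons (a : Fin n) (l : List (Fin n)) :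
    pr A h2 (a :: l) = simpleRefl A h2 a * pr A h2 l := by simp [pr]

lemma pr_append (l l' : List (Fin n)) : pr A h2 (l ++ l') = pr A h2 l * pr A h2 l' := by
  simp [pr]

lemma pr_single (a : Fin n) : pr A h2 [a] = simpleRefl A h2 a := by simp [pr]

lemma sr_apply (s : Fin n) (v : Fin n → ℤ) :
    simpleRefl A h2 s v = v - (∑ k, A s k * v k) • rt s := by
  funext j
  by_cases h : j = s
  · subst h; simp [simpleRefl, reflFun, rt]
  · simp [simpleRefl, reflFun, rt, h]

lemma sr_sq (s : Fin n) : simpleRefl A h2 s * simpleRefl A h2 s = 1 := by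
  ext1 v
  exact reflFun_invol A h2 s v

lemma sr_inv (s : Fin n) : (simpleRefl A h2 s)⁻¹ = simpleRefl A h2 s :=
  inv_eq_of_mul_eq_one_left (sr_sq A h2 s)

lemma pr_inv (l : List (Fin n)) : (pr A h2 l)⁻¹ = pr A h2 l.reverse := by
  induction l with
  | nil => rfl
  | cons a l ih =>
    rw [pr_cons, mul_inv_rev, ih, sr_inv, List.reverse_cons, pr_append, pr_single]

lemma sum_rt (s t : Fin n) : ∑ k, A s k * rt t k = A s t := by
  simp [rt, Pi.single_apply]

lemma sr_rt (s : Fin n) : simpleRefl A h2 s (rt s) = - rt s := by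
  rw [sr_apply, sum_rt, h2]; module

lemma sr_lin (s : Fin n) (x y : Fin n → ℤ) (a b : ℤ) :
    simpleRefl A h2 s (a • x + b • y) = a • simpleRefl A h2 s x + b • simpleRefl A h2 s y := by
  have : ∑ k, A s k * (a • x + b • y) k
      = a * (∑ k, A s k * x k) + b * ∑ k, A s k * y k := by
    rw [Finset.mul_sum, Finset.mul_sum, ← Finset.sum_add_distrib]
    apply Finset.sum_congr rfl
    intro k _
    simp; ring
  rw [sr_apply, sr_apply, sr_apply, this]
  module

lemma pr_lin (l : List (Fin n)) (x y : Fin n → ℤ) (a b : ℤ) :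
    pr A h2 l (a • x + b • y) = a • pr A h2 l x + b • pr A h2 l y := by
  induction l with
  | nil => rfl
  | cons s l ih => rw [pr_cons, Equiv.Perm.mul_apply, ih, sr_lin]; rfl

lemma pr_neg (l : List (Fin n)) (x : Fin n → ℤ) :
    pr A h2 l (-x) = - pr A h2 l x := by
  have := pr_lin A h2 l x 0 (-1) 0
  simpa using this

lemma len_le (l : List (Fin n)) : weylLength A h2 (pr A h2 l) ≤ l.length :=
  Nat.sInf_le ⟨l, rfl, rfl⟩

lemma len_ex (l : List (Fin n)) :
    ∃ l', l'.length = weylLength A h2 (pr A h2 l) ∧ pr A h2 l' = pr A h2 l :=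
  Nat.sInf_mem (s := {t | ∃ l' : List (Fin n), l'.length = t ∧
    (l'.map (simpleRefl A h2)).prod = pr A h2 l}) ⟨l.length, l, rfl, rfl⟩

lemma len_app (l l' : List (Fin n)) :
    weylLength A h2 (pr A h2 (l ++ l')) ≤ weylLength A h2 (pr A h2 l) + l'.length := by
  obtain ⟨l1, h1, h3⟩ := len_ex A h2 l
  have := len_le A h2 (l1 ++ l')
  rw [pr_append, h3, ← pr_append] at this
  simpa [h1] using this

/-- alternating words -/
def alt (s t : Fin n) : ℕ → List (Fin n)
  | 0 => []
  | k + 1 => alt t s k ++ [t]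

lemma alt_len (s t : Fin n) (k : ℕ) : (alt s t k).length = k := by
  induction k generalizing s t with
  | zero => rfl
  | succ k ih => simp [alt, ih]

lemma alt_mem (s t : Fin n) (k : ℕ) : ∀ x ∈ alt s t k, x = s ∨ x = t := by
  induction k generalizing s t with
  | zero => simp [alt]
  | succ k ih =>
    intro x hx
    simp only [alt, List.mem_append, List.mem_singleton] at hx
    rcases hx with hx | hx
    · exact (ih t s x hx).symm
    · exact Or.inr hx

lemma alt_split (s t : Fin n) (k m : ℕ) :
    ∃ l1, (∀ x ∈ l1, x = s ∨ x = t) ∧ l1.length = k ∧ alt s t (k + m) = l1 ++ alt s t m := by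
  induction m generalizing s t with
  | zero => exact ⟨alt s t k, alt_mem s t k, alt_len s t k, by simp [alt]⟩
  | succ m ih =>
    obtain ⟨l1, h1, h3, h4⟩ := ih t s
    refine ⟨l1, fun x hx => (h1 x hx).symm, h3, ?_⟩
    rw [← add_assoc]
    simp [alt, h4]

lemma alt_step (s t : Fin n) (k : ℕ) (v : Fin n → ℤ) (x y : ℤ) :
    pr A h2 (alt s t (k+1)) (v + x • rt s + y • rt t)
      = pr A h2 (alt t s k)
        (v + (-(∑ k, A t k * v k) - y - A t s * x) • rt t + x • rt s) := by
  have : ∑ k, A t k * (v + x • rt s + y • rt t) k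
      = (∑ k, A t k * v k) + x * A t s + y * A t t := by
    rw [← sum_rt A t s, ← sum_rt A t t, Finset.mul_sum, Finset.mul_sum, ← Finset.sum_add_distrib,
      ← Finset.sum_add_distrib]
    apply Finset.sum_congr rfl
    intro k _
    simp; ring
  rw [alt, pr_append, pr_single, Equiv.Perm.mul_apply, sr_apply, this, h2]
  congr 1
  module

lemma alt_step0 (s t : Fin n) (k : ℕ) (x y : ℤ) :
    pr A h2 (alt s t (k+1)) (x • rt s + y • rt t)
      = pr A h2 (alt t s k) ((- y - A t s * x) • rt t + x • rt s) := by
  have := alt_step A h2 s t k 0 x y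
  simpa using this

lemma alt_zero (s t : Fin n) (v) : pr A h2 (alt s t 0) v = v := rfl

lemma alt_pos_inf (s t : Fin n) (k : ℕ) (x y : ℤ) (hx : 0 ≤ x) (hy : 0 ≤ y)
    (hst : A s t ≤ 0) (hts : A t s ≤ 0) (h4 : 4 ≤ A s t * A t s) (h : 2 * y ≤ - A t s * x) :
    ∃ x' y' : ℤ, 0 ≤ x' ∧ 0 ≤ y' ∧
      pr A h2 (alt s t k) (x • rt s + y • rt t) = x' • rt s + y' • rt t := by
  induction k generalizing s t x y with
  | zero => exact ⟨x, y, hx, hy, rfl⟩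
  | succ k ih =>
    rw [alt_step0]
    obtain ⟨x', y', hx', hy', e⟩ := ih t s (- y - A t s * x) x (by linarith) hx hts hst
      (by linarith) (by nlinarith)
    exact ⟨y', x', hy', hx', by rw [e]; abel⟩

/-- coxeter order of a pair, and positivity -/
lemma alt_fin (s t : Fin n) 
    (hst : A s t ≤ 0) (hts : A t s ≤ 0) (h0 : A s t = 0 ↔ A t s = 0) (h4 : A s t * A t s < 4) :
    ∃ m : ℕ, 0 < m ∧ pr A h2 (alt s t m) = pr A h2 (alt t s m) ∧
      ∀ k < m, ∃ x' y' : ℤ, 0 ≤ x' ∧ 0 ≤ y' ∧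
        pr A h2 (alt s t k) (rt s) = x' • rt s + y' • rt t := by
  have hc : (A s t = 0 ∧ A t s = 0) ∨ (A s t = -1 ∧ A t s = -1) ∨ (A s t = -1 ∧ A t s = -2) ∨
      (A s t = -2 ∧ A t s = -1) ∨ (A s t = -1 ∧ A t s = -3) ∨ (A s t = -3 ∧ A t s = -1) := by
    by_cases hz : A s t = 0
    · exact Or.inl ⟨hz, h0.1 hz⟩
    · have hz' : A t s ≠ 0 := fun h => hz (h0.2 h)
      have h1 : A s t ≤ -1 := by omega
      have h1' : A t s ≤ -1 := by omega
      have h3 : -3 ≤ A s t := by nlinarith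
      have h3' : -3 ≤ A t s := by nlinarith
      generalize A s t = a at *
      generalize A t s = b at *
      interval_cases a <;> interval_cases b <;> simp_all
  have key : ∀ k, pr A h2 (alt s t k) (rt s)
      = pr A h2 (alt s t k) ((1:ℤ) • rt s + (0:ℤ) • rt t) := by intro k; simp
  have key2 : ∀ k (v : Fin n → ℤ) (s t : Fin n), pr A h2 (alt s t k) v
      = pr A h2 (alt s t k) (v + (0:ℤ) • rt s + (0:ℤ) • rt t) := by intro k v s t; simp
  rcases hc with ⟨e1, e2⟩ | ⟨e1, e2⟩ | ⟨e1, e2⟩ | ⟨e1, e2⟩ | ⟨e1, e2⟩ | ⟨e1, e2⟩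
  on_goal 1 => refine ⟨2, by norm_num, ?_, ?_⟩
  on_goal 3 => refine ⟨3, by norm_num, ?_, ?_⟩
  on_goal 5 => refine ⟨4, by norm_num, ?_, ?_⟩
  on_goal 7 => refine ⟨4, by norm_num, ?_, ?_⟩
  on_goal 9 => refine ⟨6, by norm_num, ?_, ?_⟩
  on_goal 11 => refine ⟨6, by norm_num, ?_, ?_⟩
  all_goals first
    | (intro k hk
       rw [key]
       interval_cases k <;> simp only [alt_step0, alt_zero, e1, e2] <;>
       first
        | exact ⟨_, _, by norm_num, by norm_num, rfl⟩
        | exact ⟨_, _, by norm_num, by norm_num, add_comm _ _⟩)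
    | (ext1 v
       rw [key2, key2 _ _ t s]
       simp only [alt_step, alt_zero, e1, e2]
       module)

lemma dihedral (s t : Fin n) 
    (hst : A s t ≤ 0) (hts : A t s ≤ 0) (h0 : A s t = 0 ↔ A t s = 0) (l : List (Fin n))
    (hl : ∀ x ∈ l, x = s ∨ x = t)
    (H1 : ∀ l', (∀ x ∈ l', x = s ∨ x = t) → pr A h2 l' = pr A h2 l → l.length ≤ l'.length)
    (H2 : ∀ l', (∀ x ∈ l', x = s ∨ x = t) → pr A h2 l' = pr A h2 (l ++ [s]) →
      l.length ≤ l'.length) :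
    ∃ x' y' : ℤ, 0 ≤ x' ∧ 0 ≤ y' ∧ pr A h2 l (rt s) = x' • rt s + y' • rt t := by
  have hkey : ∀ (l : List (Fin n)) (s t : Fin n), (∀ x ∈ l, x = s ∨ x = t) →
    (∀ l', (∀ x ∈ l', x = s ∨ x = t) → pr A h2 l' = pr A h2 l → l.length ≤ l'.length) →
    (∀ l', (∀ x ∈ l', x = s ∨ x = t) → pr A h2 l' = pr A h2 (l ++ [s]) →
      l.length ≤ l'.length) → l = alt s t l.length := by
    intro l
    induction l using List.reverseRecOn with
    | nil => intros; rfl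
    | append_singleton l0 x ih =>
      intro s t hl H1 H2
      have hl0 : ∀ y ∈ l0, y = s ∨ y = t := fun y hy => hl y (by simp [hy])
      rcases hl x (by simp) with rfl | rfl
      · exfalso
        have := H2 l0 hl0 (by
          simp only [pr_append, pr_single]; rw [mul_assoc, sr_sq, mul_one])
        simp at this
      · have := ih x s (fun y hy => (hl0 y hy).symm) ?_ ?_
        · simp only [List.length_append, List.length_singleton, alt]
          rw [← this]
        · intro l' hl' e
          have := H1 (l' ++ [x]) (by
            intro y hy
            simp only [List.mem_append, List.mem_singleton] at hy
            rcases hy with hy | hy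
            · exact (hl' y hy).symm
            · exact Or.inr hy) (by rw [pr_append, e, pr_append])
          simpa using this
        · intro l' hl' e
          have := H1 l' (fun y hy => (hl' y hy).symm) e
          simp at this; omega
  have hlalt := hkey l s t hl H1 H2
  by_cases h4 : A s t * A t s < 4
  · obtain ⟨m, hm, hbr, hpos⟩ := alt_fin A h2 s t hst hts h0 h4
    by_cases hk : l.length < m
    · rw [hlalt]; exact hpos _ hk
    · exfalso
      obtain ⟨k, hk⟩ := Nat.exists_eq_add_of_le' (not_lt.1 hk)
      obtain ⟨l1, h1, h3, h5⟩ := alt_split s t k m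
      rw [← hk, ← hlalt] at h5
      obtain ⟨m, rfl⟩ : ∃ m', m = m' + 1 := ⟨m - 1, by omega⟩
      have := H2 (l1 ++ alt s t m) (by
        intro y hy
        rcases List.mem_append.1 hy with hy | hy
        · exact h1 y hy
        · exact alt_mem _ _ _ y hy) (by
          rw [pr_append _ _ l, h5, pr_append _ _ l1 (alt s t (m+1)), hbr, alt]
          simp only [pr_append, pr_single]
          simp only [mul_assoc, sr_sq, mul_one])
      simp [alt_len] at this
      omega
  · rw [hlalt]
    have := alt_pos_inf A h2 s t l.length 1 0 (by norm_num) le_rfl hst hts (by omega) (by omega)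
    simpa using this


lemma pos_of_len (hoff : ∀ i j, i ≠ j → A i j ≤ 0) (hz : ∀ i j, A i j = 0 → A j i = 0)
    (N : ℕ) : ∀ (l : List (Fin n)) (s : Fin n), weylLength A h2 (pr A h2 l) ≤ N →
    weylLength A h2 (pr A h2 l) ≤ weylLength A h2 (pr A h2 (l ++ [s])) →
    0 ≤ pr A h2 l (rt s) := by
  have rt_pos : ∀ s : Fin n, 0 ≤ rt s := by
    intro s; unfold rt; rw [Pi.single_nonneg]; norm_num
  induction N with
  | zero =>
    intro l s hN _
    obtain ⟨l', h1, h3⟩ := len_ex A h2 l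
    have : l' = [] := List.length_eq_zero_iff.1 (by omega)
    rw [← h3, this, pr_nil]
    exact rt_pos s
  | succ N ih =>
    intro l s hN hs
    obtain ⟨l', h1, h3⟩ := len_ex A h2 l
    rcases List.eq_nil_or_concat l' with rfl | ⟨l0, t, rfl⟩
    · rw [← h3, pr_nil]; exact rt_pos s
    rw [List.concat_eq_append] at h1 h3
    have hs' : weylLength A h2 (pr A h2 l) ≤ weylLength A h2 (pr A h2 l * simpleRefl A h2 s) := by
      rwa [pr_append, pr_single] at hs
    have hne : s ≠ t := by
      rintro rfl
      rw [← h3, pr_append, pr_single, mul_assoc, sr_sq, mul_one, ← pr_single, ← pr_append] at hs'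
      have h5 := len_le A h2 l0
      rw [h3, ← h1] at hs'
      simp at hs'
      omega
    -- minimal decomposition
    let P : ℕ → Prop := fun k => ∃ v d : List (Fin n), weylLength A h2 (pr A h2 v) = k ∧
      (∀ x ∈ d, x = s ∨ x = t) ∧ pr A h2 (v ++ d) = pr A h2 l ∧
      k + d.length ≤ weylLength A h2 (pr A h2 l)
    have hP0 : P (weylLength A h2 (pr A h2 l0)) := by
      refine ⟨l0, [t], rfl, by simp, h3, ?_⟩
      have := len_le A h2 l0
      rw [← h1]; simpa using this
    classical
    have hPe : ∃ k, P k := ⟨_, hP0⟩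
    obtain ⟨v, d, hv, hd, hvd, hlen⟩ := Nat.find_spec hPe
    have hmin : ∀ k, P k → Nat.find hPe ≤ k := fun k hk => Nat.find_min' hPe hk
    rw [← hv] at hmin hlen
    have hvN : weylLength A h2 (pr A h2 v) ≤ N := by
      have := hmin _ hP0
      have h5 := len_le A h2 l0
      simp at h1
      omega
    have hpos : ∀ x, (x = s ∨ x = t) → 0 ≤ pr A h2 v (rt x) := by
      intro x hx
      apply ih v x hvN
      by_contra hc
      have hPx : P (weylLength A h2 (pr A h2 (v ++ [x]))) := by
        refine ⟨v ++ [x], x :: d, rfl, ?_, ?_, ?_⟩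
        · intro y hy
          rcases List.mem_cons.1 hy with rfl | hy
          · exact hx
          · exact hd y hy
        · rw [← hvd]
          rw [pr_append, pr_append, pr_single, pr_cons, pr_append]
          rw [mul_assoc, ← mul_assoc (simpleRefl A h2 x), sr_sq, one_mul]
        · simp; omega
      have := hmin _ hPx
      omega
    obtain ⟨x', y', hx', hy', e⟩ := dihedral A h2 s t (hoff s t hne) (hoff t s hne.symm)
      ⟨hz s t, hz t s⟩ d hd (by
        intro l' hl' e
        have := len_app A h2 v l'
        rw [pr_append, e, ← pr_append, hvd] at this
        omega) (by
        intro l' hl' e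
        have := len_app A h2 v l'
        rw [pr_append, e, ← pr_append, ← List.append_assoc, pr_append, hvd, ← pr_append] at this
        omega)
    rw [← hvd, pr_append, Equiv.Perm.mul_apply, e, pr_lin]
    have e1 := hpos s (Or.inl rfl)
    have e2 := hpos t (Or.inr rfl)
    exact add_nonneg (smul_nonneg hx' e1) (smul_nonneg hy' e2)

lemma pr_app_app (l : List (Fin n)) (s : Fin n) : pr A h2 (l ++ [s] ++ [s]) = pr A h2 l := by
  simp only [pr_append, pr_single]; rw [mul_assoc, sr_sq, mul_one]

lemma neg_of_len (hoff : ∀ i j, i ≠ j → A i j ≤ 0) (hz : ∀ i j, A i j = 0 → A j i = 0)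
    (l : List (Fin n)) (s : Fin n) 
    (h : weylLength A h2 (pr A h2 (l ++ [s])) ≤ weylLength A h2 (pr A h2 l)) :
    pr A h2 l (rt s) ≤ 0 := by
  have := pos_of_len A h2 hoff hz _ (l ++ [s]) s le_rfl (by rwa [pr_app_app])
  rw [pr_append, Equiv.Perm.mul_apply, pr_single, sr_rt, pr_neg] at this
  exact neg_nonneg.1 this

lemma sign_coh (hoff : ∀ i j, i ≠ j → A i j ≤ 0) (hz : ∀ i j, A i j = 0 → A j i = 0)
    (l : List (Fin n)) (s : Fin n) : 0 ≤ pr A h2 l (rt s) ∨ pr A h2 l (rt s) ≤ 0 := by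
  rcases le_total (weylLength A h2 (pr A h2 (l ++ [s]))) (weylLength A h2 (pr A h2 l)) with h | h
  · exact Or.inr (neg_of_len A h2 hoff hz l s h)
  · exact Or.inl (pos_of_len A h2 hoff hz _ l s le_rfl h)

lemma rt_ne (s : Fin n) : rt s ≠ 0 := by
  intro h
  have := congrFun h s
  simp [rt] at this

lemma len_lt (hoff : ∀ i j, i ≠ j → A i j ≤ 0) (hz : ∀ i j, A i j = 0 → A j i = 0)
    (l : List (Fin n)) (s : Fin n) (h : 0 ≤ pr A h2 l (rt s)) :
    weylLength A h2 (pr A h2 l) < weylLength A h2 (pr A h2 (l ++ [s])) := by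
  by_contra hc
  have h3 := neg_of_len A h2 hoff hz l s (not_lt.1 hc)
  have h4 : pr A h2 l (rt s) = 0 := le_antisymm h3 h
  have h5 : pr A h2 l 0 = 0 := by simpa using pr_lin A h2 l 0 0 0 0
  exact rt_ne s ((pr A h2 l).injective (h4.trans h5.symm))

/-- `A v` -/
def mv (v : Fin n → ℤ) (i : Fin n) : ℤ := ∑ k, A i k * v k

lemma mv_add (v w : Fin n → ℤ) (c : ℤ) (i : Fin n) :
    mv A (v + c • w) i = mv A v i + c * mv A w i := by
  unfold mv
  rw [Finset.mul_sum, ← Finset.sum_add_distrib]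
  apply Finset.sum_congr rfl
  intro k _
  simp; ring

lemma mv_rt (s i : Fin n) : mv A (rt s) i = A i s := sum_rt A i s

/-- bilinear form -/
def bf (d : Fin n → ℤ) (x y : Fin n → ℤ) : ℤ := ∑ i, d i * x i * mv A y i

lemma bf_symm (d : Fin n → ℤ) (hd : ∀ i j, d i * A i j = d j * A j i) (x y : Fin n → ℤ) :
    bf A d x y = bf A d y x := by
  unfold bf mv
  simp only [Finset.mul_sum]
  rw [Finset.sum_comm]
  refine Finset.sum_congr rfl fun i _ => Finset.sum_congr rfl fun j _ => ?_
  linear_combination (x j * y i) * hd j i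

lemma bf_add (d : Fin n → ℤ) (x y z : Fin n → ℤ) (c : ℤ) :
    bf A d x (y + c • z) = bf A d x y + c * bf A d x z := by
  unfold bf
  simp only [mv_add, Finset.mul_sum]
  rw [← Finset.sum_add_distrib]
  refine Finset.sum_congr rfl fun i _ => ?_
  ring

lemma bf_rt (d : Fin n → ℤ) (s : Fin n) (y : Fin n → ℤ) :
    bf A d (rt s) y = d s * mv A y s := by
  simp [bf, rt, Pi.single_apply]

lemma bf_refl (d : Fin n → ℤ) (hd : ∀ i j, d i * A i j = d j * A j i) (s : Fin n)
    (x : Fin n → ℤ) : bf A d (simpleRefl A h2 s x) (simpleRefl A h2 s x) = bf A d x x := by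
  have e : simpleRefl A h2 s x = x + (-(mv A x s)) • rt s := by
    rw [sr_apply, mv]; module
  rw [e, bf_add, bf_symm A d hd _ x, bf_symm A d hd _ (rt s), bf_add, bf_add,
    bf_symm A d hd x (rt s), bf_rt, bf_rt, mv_rt, h2]
  ring

lemma bf_bound (hoff : ∀ i j, i ≠ j → A i j ≤ 0) (d : Fin n → ℤ) (hd0 : ∀ i, 0 < d i)
    (hd : ∀ i j, d i * A i j = d j * A j i) (S : Fin n → ℤ) (hS : ∀ i, 0 < S i)
    (hAS : ∀ i, 0 < mv A S i) (x : Fin n → ℤ) (k : Fin n) : x k ^ 2 ≤ S k * bf A d x x := by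
  have hSq : ∀ i, (0:ℚ) < S i := fun i => by exact_mod_cast hS i
  have e1 : (bf A d x x : ℚ) = ∑ i, ∑ j, ((d i * A i j : ℤ) : ℚ) * x i * x j := by
    unfold bf mv
    push_cast
    refine Finset.sum_congr rfl fun i _ => ?_
    rw [Finset.mul_sum]
    refine Finset.sum_congr rfl fun j _ => ?_
    ring
  have e2 : ∑ i, ∑ j, ((d i * A i j : ℤ) : ℚ) * (S j / S i * x i ^ 2 / 2 + S i / S j * x j ^ 2 / 2)
      ≤ ∑ i, ∑ j, ((d i * A i j : ℤ) : ℚ) * x i * x j := by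
    refine Finset.sum_le_sum fun i _ => Finset.sum_le_sum fun j _ => ?_
    have hi := hSq i
    have hj := hSq j
    by_cases hij : i = j
    · subst hij
      apply le_of_eq
      field_simp
      ring
    · have hB : ((d i * A i j : ℤ) : ℚ) ≤ 0 := by
        exact_mod_cast mul_nonpos_of_nonneg_of_nonpos (hd0 i).le (hoff i j hij)
      rw [mul_assoc]
      apply mul_le_mul_of_nonpos_left _ hB
      have : (S j / S i * x i ^ 2 / 2 + S i / S j * x j ^ 2 / 2 - x i * x j : ℚ)
        = (S j * x i - S i * x j) ^ 2 / (2 * S i * S j) := by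
        field_simp
        ring
      have h3 : (0:ℚ) ≤ (S j * x i - S i * x j) ^ 2 / (2 * S i * S j) := by positivity
      linarith
  have e3 : ∑ i, ∑ j, ((d i * A i j : ℤ) : ℚ) * (S j / S i * x i ^ 2 / 2 + S i / S j * x j ^ 2 / 2)
      = ∑ i, (d i : ℚ) * (x i ^ 2 / S i) * (mv A S i : ℚ) := by
    simp only [mul_add, Finset.sum_add_distrib]
    rw [Finset.sum_comm (f := fun i j => ((d i * A i j : ℤ) : ℚ) * (S i / S j * x j ^ 2 / 2)),
      ← Finset.sum_add_distrib]
    refine Finset.sum_congr rfl fun i _ => ?_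
    unfold mv
    push_cast
    rw [← Finset.sum_add_distrib, Finset.mul_sum]
    refine Finset.sum_congr rfl fun j _ => ?_
    have : (d j * A j i : ℚ) = d i * A i j := by exact_mod_cast (hd i j).symm
    rw [this]
    ring
  have e4 : (x k ^ 2 / S k : ℚ) ≤ ∑ i, (d i : ℚ) * (x i ^ 2 / S i) * (mv A S i : ℚ) := by
    have hterm : ∀ i, (x i ^ 2 / S i : ℚ) ≤ (d i : ℚ) * (x i ^ 2 / S i) * (mv A S i : ℚ) := by
      intro i
      have hi := hSq i
      have a1 : (1:ℚ) ≤ d i := by exact_mod_cast hd0 i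
      have a2 : (1:ℚ) ≤ mv A S i := by exact_mod_cast hAS i
      have a3 : (0:ℚ) ≤ x i ^ 2 / S i := by positivity
      have a4 : (1:ℚ) ≤ d i * mv A S i := one_le_mul_of_one_le_of_one_le a1 a2
      nlinarith
    refine (hterm k).trans ?_
    refine Finset.single_le_sum (f := fun i => (d i : ℚ) * (x i ^ 2 / S i) * (mv A S i : ℚ)) ?_ (Finset.mem_univ k)
    intro i _
    have hi := hSq i
    exact le_trans (by positivity) (hterm i)
  have e5 : (x k ^ 2 / S k : ℚ) ≤ bf A d x x := by rw [e1]; rw [← e3] at e4; exact e4.trans e2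
  rw [div_le_iff₀ (hSq k)] at e5
  rw [mul_comm]
  exact_mod_cast e5

lemma mem_weyl (w : Equiv.Perm (Fin n → ℤ)) (hw : w ∈ weylGroup A h2) : ∃ l, w = pr A h2 l := by
  unfold weylGroup at hw
  induction hw using Subgroup.closure_induction with
  | mem x hx => obtain ⟨s, rfl⟩ := hx; exact ⟨[s], (pr_single A h2 s).symm⟩
  | one => exact ⟨[], rfl⟩
  | mul x y _ _ hx hy =>
    obtain ⟨l, rfl⟩ := hx
    obtain ⟨l', rfl⟩ := hy
    exact ⟨l ++ l', (pr_append A h2 l l').symm⟩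
  | inv x _ hx =>
    obtain ⟨l, rfl⟩ := hx
    exact ⟨_, pr_inv A h2 l⟩

lemma pr_mem (l : List (Fin n)) : pr A h2 l ∈ weylGroup A h2 := by
  induction l with
  | nil => exact one_mem _
  | cons a l ih =>
    rw [pr_cons]
    exact mul_mem (Subgroup.subset_closure ⟨a, rfl⟩) ih

lemma pr_ext (l l' : List (Fin n)) (h : ∀ s, pr A h2 l (rt s) = pr A h2 l' (rt s)) :
    pr A h2 l = pr A h2 l' := by
  have hs : ∀ (l : List (Fin n)) (x : Fin n → ℤ) (T : Finset (Fin n)),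
      pr A h2 l (∑ i ∈ T, x i • rt i) = ∑ i ∈ T, x i • pr A h2 l (rt i) := by
    intro l x T
    classical
    induction T using Finset.induction_on with
    | empty => simpa using pr_lin A h2 l 0 0 0 0
    | insert a T ha ih =>
      rw [Finset.sum_insert ha, Finset.sum_insert ha, ← ih]
      have := pr_lin A h2 l (rt a) (∑ i ∈ T, x i • rt i) (x a) 1
      simpa using this
  ext1 x
  have hx : x = ∑ i, x i • rt i := by
    funext j
    simp [rt, Finset.sum_apply, Pi.single_apply]
  rw [hx, hs, hs]
  simp only [h]

lemma finite_of_pos (hoff : ∀ i j, i ≠ j → A i j ≤ 0) (d : Fin n → ℤ) (hd0 : ∀ i, 0 < d i)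
    (hd : ∀ i j, d i * A i j = d j * A j i) (S : Fin n → ℤ) (hS : ∀ i, 0 < S i)
    (hAS : ∀ i, 0 < mv A S i) :
    Set.Finite (weylGroup A h2 : Set (Equiv.Perm (Fin n → ℤ))) := by
  have hq : ∀ (l : List (Fin n)) x, bf A d (pr A h2 l x) (pr A h2 l x) = bf A d x x := by
    intro l x
    induction l with
    | nil => rfl
    | cons a l ih => rw [pr_cons, Equiv.Perm.mul_apply, bf_refl A h2 d hd, ih]
  have hfin : ∀ C : ℤ, Set.Finite {x : Fin n → ℤ | bf A d x x = C} := by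
    intro C
    have : Set.Finite (Set.pi Set.univ (fun k : Fin n => Set.Icc (-(S k * C)) (S k * C))) :=
      Set.Finite.pi (fun k => Set.finite_Icc _ _)
    refine this.subset ?_
    intro x hx k _
    have hb := bf_bound A hoff d hd0 hd S hS hAS x k
    have hx' : bf A d x x = C := hx
    rw [hx'] at hb
    constructor <;> nlinarith [sq_nonneg (x k), Int.le_self_sq (x k), Int.le_self_sq (-x k)]
  let f : Equiv.Perm (Fin n → ℤ) → (Fin n → (Fin n → ℤ)) := fun w s => w (rt s)
  refine Set.Finite.of_finite_image (f := f) ?_ ?_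
  · refine (Set.Finite.pi' (fun s : Fin n => hfin (bf A d (rt s) (rt s)))).subset ?_
    rintro _ ⟨w, hw, rfl⟩ s
    obtain ⟨l, rfl⟩ := mem_weyl A h2 w hw
    exact hq l (rt s)
  · intro w hw w' hw' e
    obtain ⟨l, rfl⟩ := mem_weyl A h2 w hw
    obtain ⟨l', rfl⟩ := mem_weyl A h2 w' hw'
    exact pr_ext A h2 l l' (fun s => congrFun e s)

lemma strictify (h2 : ∀ i, A i i = 2) (hoff : ∀ i j, i ≠ j → A i j ≤ 0)
    (hind : ∀ s : Set (Fin n), s.Nonempty → sᶜ.Nonempty → ∃ i ∈ s, ∃ j ∈ sᶜ, A i j ≠ 0)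
    (S : Fin n → ℤ) (hS : 0 ≤ S) (hAS : ∀ i, 0 ≤ mv A S i) (u : Fin n) (hu : 0 < mv A S u) :
    ∃ S : Fin n → ℤ, (∀ i, 0 < S i) ∧ (∀ i, 0 < mv A S i) := by
  have hpos : ∀ i, 0 < S i := by
    by_contra hc
    push Not at hc
    obtain ⟨i0, hi0⟩ := hc
    obtain ⟨i, hi, j, hj, hij⟩ := hind {i | S i = 0} ⟨i0, le_antisymm hi0 (hS i0)⟩ (by
      by_contra hne
      rw [Set.not_nonempty_iff_eq_empty, Set.compl_empty_iff] at hne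
      have hz : ∀ i, S i = 0 := fun i => by
        have : i ∈ {i | S i = 0} := hne ▸ Set.mem_univ i
        exact this
      have : mv A S u = 0 := by simp [mv, hz]
      omega)
    have hi' : S i = 0 := hi
    have hj' : S j ≠ 0 := hj
    have hne : i ≠ j := by rintro rfl; exact hj' hi'
    have h1 : mv A S i < 0 := by
      unfold mv
      apply Finset.sum_neg' 
      · intro k _
        by_cases hk : i = k
        · subst hk; simp [hi']
        · exact mul_nonpos_of_nonpos_of_nonneg (hoff i k hk) (hS k)
      · have := hS j
        have a1 := lt_of_le_of_ne (hoff i j hne) hij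
        have a2 : 0 < S j := lt_of_le_of_ne (hS j) (Ne.symm hj')
        exact ⟨j, Finset.mem_univ j, mul_neg_of_neg_of_pos a1 a2⟩
    have := hAS i
    omega
  clear hS
  -- grow the set of strictly positive entries
  generalize hN : (Finset.univ.filter (fun i => mv A S i = 0)).card = N
  induction N using Nat.strong_induction_on generalizing S with
  | _ N ih =>
  by_cases hall : ∀ i, 0 < mv A S i
  · exact ⟨S, hpos, hall⟩
  push Not at hall
  obtain ⟨i0, hi0⟩ := hall
  obtain ⟨i, hi, j, hj, hij⟩ := hind {i | mv A S i = 0} ⟨i0, le_antisymm hi0 (hAS i0)⟩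
    ⟨u, by simp; omega⟩
  have hi' : mv A S i = 0 := hi
  have hj' : 0 < mv A S j := lt_of_le_of_ne (hAS j) (Ne.symm hj)
  have hne : i ≠ j := by rintro rfl; omega
  have hS' : ∀ k, mv A ((3:ℤ) • S + (-1 : ℤ) • rt j) k = 3 * mv A S k - A k j := by
    intro k
    have h1 := mv_add A ((3:ℤ) • S) (rt j) (-1) k
    have h3 := mv_add A 0 S 3 k
    have h4 : mv A 0 k = 0 := by simp [mv]
    rw [zero_add] at h3
    rw [h1, h3, mv_rt, h4]; ring
  have hgrow : ∀ k, 0 < mv A S k → 0 < mv A ((3:ℤ) • S + (-1 : ℤ) • rt j) k := by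
    intro k hk
    rw [hS']
    by_cases hkj : k = j
    · subst hkj; rw [h2]; omega
    · have := hoff k j hkj; omega
  have hge : ∀ k, 0 ≤ mv A ((3:ℤ) • S + (-1 : ℤ) • rt j) k := by
    intro k
    rcases (hAS k).lt_or_eq with h | h
    · exact (hgrow k h).le
    · rw [hS']
      have hkj : k ≠ j := by rintro rfl; omega
      have := hoff k j hkj; omega
  refine ih _ ?_ ((3:ℤ) • S + (-1 : ℤ) • rt j) hge (hgrow u hu) ?_ rfl
  · rw [← hN]
    apply Finset.card_lt_card
    rw [Finset.ssubset_iff_of_subset]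
    · refine ⟨i, by simp [hi'], ?_⟩
      simp only [Finset.mem_filter, Finset.mem_univ, true_and, hS']
      have := hoff i j hne
      omega
    · intro k hk
      simp only [Finset.mem_filter, Finset.mem_univ, true_and] at hk ⊢
      by_contra hc
      have := hgrow k (lt_of_le_of_ne (hAS k) (Ne.symm hc))
      omega
  · intro k
    have := hpos k
    by_cases hk : k = j
    · subst hk; simp [rt]; omega
    · simp [rt, hk]; omega

lemma hammock (u : ℕ → Fin n) (r : ℕ → Fin n → ℤ)
    (hr1 : ∀ k w, w ≠ u k → r k w < r k (u k))
    (hr2 : ∀ k w, w ≠ u k → r (k+1) (u k) < r (k+1) w)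
    (hr3 : ∀ k w w', w ≠ u k → w' ≠ u k → (r (k+1) w' < r (k+1) w ↔ r k w' < r k w))
    (y : ℕ → Fin n → ℤ) (hy : ∀ k, y (k+1) = simpleRefl A h2 (u k) (y k))
    (j : ℕ) (c : ℤ) (hbase : y (j+1) = c • rt (u j)) (m : ℕ)
    (hpos : ∀ k, j < k → k ≤ j + 1 + m → 0 ≤ y k) :
    ∃ S : Fin n → ℤ, 0 ≤ S ∧ ∀ w, mv A S w = c * rt (u j) w + y (j+1+m) w +
      ∑ w', if r (j+1+m) w' < r (j+1+m) w then A w w' * y (j+1+m) w' else 0 := by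
  induction m with
  | zero =>
    refine ⟨y (j+1), hpos (j+1) (by omega) (by omega), ?_⟩
    intro w
    have e0 : mv A (y (j+1)) w = c * A w (u j) := by
      have := mv_add A 0 (rt (u j)) c w
      have h4 : mv A 0 w = 0 := by simp [mv]
      rw [zero_add, mv_rt, h4, zero_add] at this
      rw [hbase, this]
    rw [e0]
    simp only [add_zero]
    rw [Finset.sum_eq_single (u j)]
    · by_cases hw : w = u j
      · subst hw
        simp [hbase, rt, h2]; ring
      · have := hr2 j w hw
        simp [hbase, rt, hw, this]; ring
    · intro b _ hb
      simp [hbase, rt, hb]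
    · simp
  | succ m ih =>
    obtain ⟨S, hS, hmv⟩ := ih (fun k h1 h3 => hpos k h1 (by omega))
    have hyk := hpos (j+1+(m+1)) (by omega) le_rfl
    have hstep := hy (j+1+m)
    rw [← add_assoc] at hyk ⊢
    generalize j + 1 + m = k at *
    have hy1 : ∀ w, w ≠ u k → y (k+1) w = y k w := by
      intro w hw
      rw [hstep, sr_apply]; simp [rt, hw]
    have hy2 : y (k+1) (u k) = y k (u k) - mv A (y k) (u k) := by
      rw [hstep, sr_apply]; simp [rt, mv]
    refine ⟨S + (y (k+1) (u k)) • rt (u k), ?_, ?_⟩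
    · refine add_nonneg hS (smul_nonneg (hyk _) ?_)
      unfold rt; rw [Pi.single_nonneg]; norm_num
    intro w
    rw [mv_add, mv_rt, hmv w]
    by_cases hw : w = u k
    · subst hw
      have s1 : (∑ w', if r (k+1) w' < r (k+1) (u k) then A (u k) w' * y (k+1) w' else 0) = 0 := by
        apply Finset.sum_eq_zero
        intro w' _
        by_cases hw' : w' = u k
        · simp [hw']
        · have := hr2 k w' hw'
          simp [not_lt.2 this.le]
      have s2 : (∑ w', if r k w' < r k (u k) then A (u k) w' * y k w' else 0)
          = mv A (y k) (u k) - 2 * y k (u k) := by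
        unfold mv
        rw [← Finset.add_sum_erase _ (fun w' => A (u k) w' * y k w') (Finset.mem_univ (u k)),
          ← Finset.add_sum_erase _ _ (Finset.mem_univ (u k)), h2]
        simp only [lt_irrefl, if_false, zero_add, add_sub_cancel_left]
        apply Finset.sum_congr rfl
        intro w' hw'
        rw [if_pos (hr1 k w' (Finset.ne_of_mem_erase hw'))]
      rw [s1, s2, hy2, h2]; ring
    · rw [hy1 w hw,
        ← Finset.add_sum_erase _ _ (Finset.mem_univ (u k)),
        ← Finset.add_sum_erase _ (fun w' => if r (k+1) w' < r (k+1) w then A w w' * y (k+1) w' else 0)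
          (Finset.mem_univ (u k))]
      have s3 : ∑ w' ∈ Finset.univ.erase (u k),
          (if r (k+1) w' < r (k+1) w then A w w' * y (k+1) w' else 0)
          = ∑ w' ∈ Finset.univ.erase (u k), if r k w' < r k w then A w w' * y k w' else 0 := by
        apply Finset.sum_congr rfl
        intro w' hw'
        have hw'' := Finset.ne_of_mem_erase hw'
        simp only [hr3 k w w' hw hw'', hy1 w' hw'']
      rw [s3, if_neg (not_lt.2 (hr1 k w hw).le), if_pos (hr2 k w hw)]
      ring

lemma beta_nonneg (hoff : ∀ i j, i ≠ j → A i j ≤ 0) 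
    (d : Fin n → ℤ) (hd0 : ∀ i, 0 < d i)
    (hd : ∀ i j, d i * A i j = d j * A j i)
    (hind : ∀ s : Set (Fin n), s.Nonempty → sᶜ.Nonempty → ∃ i ∈ s, ∃ j ∈ sᶜ, A i j ≠ 0)
    (hinf : Set.Infinite (weylGroup A h2 : Set (Equiv.Perm (Fin n → ℤ))))
    (hz : ∀ i j, A i j = 0 → A j i = 0)
    (u : ℕ → Fin n) (r : ℕ → Fin n → ℤ)
    (hr1 : ∀ k w, w ≠ u k → r k w < r k (u k))
    (hr2 : ∀ k w, w ≠ u k → r (k+1) (u k) < r (k+1) w)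
    (hr3 : ∀ k w w', w ≠ u k → w' ≠ u k → (r (k+1) w' < r (k+1) w ↔ r k w' < r k w))
    (K : ℕ) : 0 ≤ pr A h2 ((List.range K).map u) (rt (u K)) := by
  classical
  by_contra hneg
  set β := pr A h2 ((List.range K).map u) (rt (u K)) with hβ
  let y : ℕ → Fin n → ℤ := fun k => (pr A h2 ((List.range k).map u))⁻¹ β
  have hy : ∀ k, y (k+1) = simpleRefl A h2 (u k) (y k) := by
    intro k
    simp only [y]
    rw [List.range_succ, List.map_append, List.map_singleton, pr_append, pr_single, mul_inv_rev,
      sr_inv]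
    rfl
  have hyK : y K = rt (u K) := by
    simp only [y, hβ]
    exact Equiv.symm_apply_apply _ _
  have hy0 : y 0 = β := rfl
  have hsign : ∀ k, 0 ≤ y k ∨ y k ≤ 0 := by
    intro k
    have : y k = pr A h2 (((List.range k).map u).reverse ++ (List.range K).map u) (rt (u K)) := by
      rw [pr_append, ← pr_inv]; rfl
    rw [this]
    exact sign_coh A h2 hoff hz _ _
  have rt_pos : ∀ s : Fin n, 0 ≤ rt s := by
    intro s; unfold rt; rw [Pi.single_nonneg]; norm_num
  let P : ℕ → Prop := fun k => ¬ 0 ≤ y k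
  have hP0 : P 0 := by simpa only [P, hy0] using hneg
  have hPj : P (Nat.findGreatest P K) := Nat.findGreatest_spec (Nat.zero_le K) hP0
  have hjK := Nat.findGreatest_le (P := P) K
  have hgt : ∀ k, Nat.findGreatest P K < k → k ≤ K → 0 ≤ y k := fun k h1 h3 =>
    not_not.1 (Nat.findGreatest_is_greatest h1 h3)
  generalize Nat.findGreatest P K = j at *
  have hlt : j < K := by
    rcases hjK.lt_or_eq with h | h
    · exact h
    · exfalso
      apply hPj
      rw [h, hyK]
      exact rt_pos _
  have hyj : y j ≤ 0 := (hsign j).resolve_left hPj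
  have hyj1 := hgt (j+1) (by omega) (by omega)
  have hbase : y (j+1) = (y (j+1) (u j)) • rt (u j) := by
    funext w
    by_cases hw : w = u j
    · subst hw; simp [rt]
    · have e : y (j+1) w = y j w := by
        rw [hy, sr_apply]; simp [rt, hw]
      have h1 := hyj1 w
      have h3 := hyj w
      simp only [Pi.zero_apply] at h1 h3
      simp [rt, hw]
      omega
  obtain ⟨m, hm⟩ := Nat.exists_eq_add_of_le (show j + 1 ≤ K by omega)
  obtain ⟨S, hS, hmv⟩ := hammock A h2 u r hr1 hr2 hr3 y hy j _ hbase m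
    (fun k h1 h3 => hgt k h1 (by omega))
  rw [← hm] at hmv
  have hsum : ∀ w, (∑ w', if r K w' < r K w then A w w' * y K w' else 0) = 0 := by
    intro w
    apply Finset.sum_eq_zero
    intro w' _
    by_cases hw' : w' = u K
    · subst hw'
      have : ¬ r K (u K) < r K w := by
        by_cases hw : w = u K
        · simp [hw]
        · exact not_lt.2 (hr1 K w hw).le
      simp [this]
    · simp [hyK, rt, hw']
  have hmv' : ∀ w, mv A S w = y (j+1) (u j) * rt (u j) w + rt (u K) w := by
    intro w; rw [hmv, hsum, add_zero, hyK]
  have hge : ∀ w, 0 ≤ y (j+1) (u j) * rt (u j) w := fun w =>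
    mul_nonneg (hyj1 _) (rt_pos _ w)
  obtain ⟨S', hS', hAS'⟩ := strictify A h2 hoff hind S hS
    (fun w => by rw [hmv']; exact add_nonneg (hge w) (rt_pos _ w)) (u K) (by
      rw [hmv']
      have : rt (u K) (u K) = 1 := by simp [rt]
      have := hge (u K)
      omega)
  exact hinf (finite_of_pos A h2 hoff d hd0 hd S' hS' hAS')

lemma len_inv_le (l : List (Fin n)) :
    weylLength A h2 (pr A h2 l)⁻¹ ≤ weylLength A h2 (pr A h2 l) := by
  obtain ⟨l', h1, h3⟩ := len_ex A h2 l
  have := len_le A h2 l'.reverse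
  rw [← pr_inv, h3, List.length_reverse, h1] at this
  exact this

lemma len_inv (l : List (Fin n)) :
    weylLength A h2 (pr A h2 l)⁻¹ = weylLength A h2 (pr A h2 l) := by
  apply le_antisymm (len_inv_le A h2 l)
  have := len_inv_le A h2 l.reverse
  rwa [← pr_inv, inv_inv] at this

lemma emod_step (a N : ℤ) (hN : 0 < N) :
    ((a + 1) % N = 0 ∧ a % N = N - 1) ∨
      ((a + 1) % N ≠ 0 ∧ (a + 1) % N = a % N + 1 ∧ a % N < N - 1) := by
  have h0 := Int.emod_nonneg a hN.ne'
  have h1 := Int.emod_lt_of_pos a hN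
  have e := Int.emod_add_mul_ediv a N
  have e' : a + 1 = (a % N + 1) + N * (a / N) := by omega
  by_cases h : a % N + 1 = N
  · left
    refine ⟨?_, by omega⟩
    rw [e', h]; simp
  · right
    have : (a + 1) % N = a % N + 1 := by
      rw [e', Int.add_mul_emod_self_left, Int.emod_eq_of_lt (by omega) (by omega)]
    exact ⟨by omega, this, by omega⟩

end Aux

/-- For an indecomposable symmetrizable generalized Cartan matrix `A`
and any Coxeter element `c = σ_{v_n} ⋯ σ_{v_1}` of the Weyl group `W(A)`,
the group `W(A)` is infinite iff `ℓ(c^m) = |m|·n` for all integers `m`. -/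
theorem stmt_0 {n : ℕ} (hn : 0 < n) (A : Matrix (Fin n) (Fin n) ℤ)
    (h2 : ∀ i, A i i = 2)
    (hoff : ∀ i j, i ≠ j → A i j ≤ 0)
    (hsym : ∃ d : Fin n → ℤ, (∀ i, 0 < d i) ∧ ∀ i j, d i * A i j = d j * A j i)
    (hind : ∀ s : Set (Fin n), s.Nonempty → sᶜ.Nonempty → ∃ i ∈ s, ∃ j ∈ sᶜ, A i j ≠ 0)
    (vs : List (Fin n)) (hnd : vs.Nodup) (hall : ∀ i : Fin n, i ∈ vs) :
    Set.Infinite (weylGroup A h2 : Set (Equiv.Perm (Fin n → ℤ))) ↔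
      ∀ m : ℤ, weylLength A h2 ((wordOf A h2 vs) ^ m) = m.natAbs * n := by
  obtain ⟨d, hd0, hd⟩ := hsym
  have hz : ∀ i j, A i j = 0 → A j i = 0 := by
    intro i j h
    have := hd i j
    rw [h, mul_zero] at this
    exact (mul_eq_zero.1 this.symm).resolve_left (hd0 j).ne'
  have hlen : vs.length = n := by
    have h1 : vs.toFinset = Finset.univ := by ext i; simp [hall i]
    rw [← List.toFinset_card_of_nodup hnd, h1]; simp
  have hc : wordOf A h2 vs = pr A h2 vs.reverse := rfl
  rw [hc]
  have hrl : vs.reverse.length = n := by simpa using hlen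
  have hrnd : vs.reverse.Nodup := List.nodup_reverse.2 hnd
  have hrall : ∀ i, i ∈ vs.reverse := fun i => by simpa using hall i
  generalize vs.reverse = rl at *
  constructor
  · intro hinf
    let u : ℕ → Fin n := fun k => rl[k % n]'(by rw [hrl]; exact Nat.mod_lt _ hn)
    have hu : ∀ k w, w = u k ↔ ((k : ℤ) - 1 - rl.idxOf w + 1) % n = 0 := by
      intro k w
      have hlt : rl.idxOf w < n := (List.idxOf_lt_length_of_mem (hrall w)).trans_eq hrl
      have e1 : (k : ℤ) - 1 - rl.idxOf w + 1 = k - rl.idxOf w := by ring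
      rw [e1, ← Int.emod_eq_emod_iff_emod_sub_eq_zero]
      have e2 : w = u k ↔ rl.idxOf w = k % n := by
        constructor
        · rintro rfl
          exact hrnd.idxOf_getElem _ _
        · intro h
          simp only [u, ← h]
          simp
      rw [e2]
      have e3 : ((rl.idxOf w : ℕ) : ℤ) % n = rl.idxOf w := by
        exact_mod_cast Nat.mod_eq_of_lt hlt
      rw [e3]
      constructor
      · intro h; exact_mod_cast h.symm
      · intro h; exact_mod_cast h.symm
    let r : ℕ → Fin n → ℤ := fun k w => ((k : ℤ) - 1 - rl.idxOf w) % n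
    have hn' : (0 : ℤ) < n := by exact_mod_cast hn
    have hr : ∀ k w, (w = u k ∧ r k w = n - 1 ∧ r (k+1) w = 0) ∨
        (w ≠ u k ∧ r (k+1) w = r k w + 1 ∧ r k w < n - 1 ∧ 0 ≤ r k w) := by
      intro k w
      have e1 : r (k+1) w = ((k : ℤ) - 1 - rl.idxOf w + 1) % n := by
        simp only [r]; congr 1; push_cast; ring
      have h0 : 0 ≤ r k w := Int.emod_nonneg _ hn'.ne'
      rcases emod_step ((k : ℤ) - 1 - rl.idxOf w) n hn' with ⟨h1, h3⟩ | ⟨h1, h3, h4⟩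
      · exact Or.inl ⟨(hu k w).2 h1, h3, by rw [e1, h1]⟩
      · exact Or.inr ⟨fun h => h1 ((hu k w).1 h), by rw [e1, h3], h4, h0⟩
    have hpos := beta_nonneg A h2 hoff d hd0 hd hind hinf hz u r
      (by
        intro k w hw
        rcases hr k w with h | h
        · exact absurd h.1 hw
        rcases hr k (u k) with h' | h'
        · omega
        · exact absurd rfl h'.1)
      (by
        intro k w hw
        rcases hr k w with h | h
        · exact absurd h.1 hw
        rcases hr k (u k) with h' | h'
        · omega
        · exact absurd rfl h'.1)
      (by
        intro k w w' hw hw'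
        rcases hr k w with h | h
        · exact absurd h.1 hw
        rcases hr k w' with h' | h'
        · exact absurd h'.1 hw'
        · omega)
    have hlenK : ∀ K, weylLength A h2 (pr A h2 ((List.range K).map u)) = K := by
      intro K
      apply le_antisymm
      · simpa using len_le A h2 ((List.range K).map u)
      · induction K with
        | zero => exact Nat.zero_le _
        | succ K ih =>
          have := len_lt A h2 hoff hz _ (u K) (hpos K)
          rw [List.range_succ, List.map_append, List.map_singleton]
          omega
    have hmapn : (List.range n).map u = rl := by
      apply List.ext_getElem
      · simp [hrl]
      · intro i h1 h3
        have : i < n := by simpa using h1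
        simp [u, Nat.mod_eq_of_lt this]
    have hpow : ∀ m : ℕ, pr A h2 ((List.range (n * m)).map u) = (pr A h2 rl) ^ m := by
      intro m
      induction m with
      | zero => simp [pr]
      | succ m ih =>
        rw [Nat.mul_succ, List.range_add, List.map_append, pr_append, ih, pow_succ]
        congr 2
        rw [List.map_map, ← hmapn]
        apply List.map_congr_left
        intro a _
        simp [u]
    have hnat : ∀ m : ℕ, weylLength A h2 ((pr A h2 rl) ^ m) = m * n := by
      intro m
      rw [← hpow, hlenK, mul_comm]
    intro m
    rcases Int.eq_nat_or_neg m with ⟨k, rfl | rfl⟩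
    · simpa using hnat k
    · rw [zpow_neg, zpow_natCast, ← hpow, len_inv, hpow, hnat]
      simp
  · intro h
    refine Set.infinite_of_injective_forall_mem (f := fun k : ℕ => (pr A h2 rl) ^ (k : ℤ)) ?_ ?_
    · intro a b hab
      have h1 := h a
      have h3 := h b
      simp only at hab
      rw [hab, h3] at h1
      simp only [Int.natAbs_natCast] at h1
      exact (Nat.eq_of_mul_eq_mul_right hn h1).symm
    · intro k
      exact zpow_mem (pr_mem A h2 rl) _
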